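/- Let Δ ≥ 9 be an integer and let G be a minimal counterexample to the bound χ'_s ≤ 3Δ − 3 for graphs with Mad < 8/3 and maximum degree at most Δ. If u is a vertex of degree 3 in G* having two neighbors v₁ and v₂ of degree 2 in G*, then at least one of v₁, v₂ is special. -/

import Mathlib

open scoped Classical

namespace StrongEC

/-- Two edges of `G` conflict for strong edge-coloring: they are distinct and either share
an endpoint or are both adjacent to a common edge of `G`. -/
def Conflict {V : Type*} (G : SimpleGraph V) (e e' : Sym2 V) : Prop :=
  e ≠ e' ∧ ((∃ v, v ∈ e ∧ v ∈ e') ∨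
    ∃ f ∈ G.edgeSet, (∃ v, v ∈ e ∧ v ∈ f) ∧ (∃ w, w ∈ e' ∧ w ∈ f))

/-- `C` is a strong edge-coloring of `G` with `k` colors. -/
def IsStrongColoring {V : Type*} (G : SimpleGraph V) {k : ℕ} (C : Sym2 V → Fin k) : Prop :=
  ∀ e ∈ G.edgeSet, ∀ e' ∈ G.edgeSet, Conflict G e e' → C e ≠ C e'

/-- `G` admits a strong `k`-edge-coloring. -/
def HasStrongColoring {V : Type*} (G : SimpleGraph V) (k : ℕ) : Prop :=
  ∃ C : Sym2 V → Fin k, IsStrongColoring G C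

/-- The strong chromatic index of `G`: the least `k` such that `G` admits a strong
`k`-edge-coloring. -/
noncomputable def strongChromaticIndex {V : Type*} (G : SimpleGraph V) : ℕ :=
  sInf {k | HasStrongColoring G k}

/-- The maximum average degree of a finite graph `G`: the supremum over nonempty vertex
subsets `A` of `2 * e(A) / |A|`, where `e(A)` is the number of edges of `G` inside `A`
(this equals the maximum of `2|E(H)|/|V(H)|` over all subgraphs `H` with at least one
vertex). -/
noncomputable def mad {V : Type*} (G : SimpleGraph V) : ℝ :=
  sSup {x : ℝ | ∃ A : Finset V, A.Nonempty ∧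
    x = 2 * ({e ∈ G.edgeSet | ∀ v ∈ e, v ∈ A}.ncard : ℝ) / (A.card : ℝ)}

/-- The graph `G*` obtained from `G` by deleting all vertices of degree 1 in `G`. -/
noncomputable def core {V : Type*} [Fintype V] (G : SimpleGraph V) : SimpleGraph V :=
  SimpleGraph.fromRel (fun u v => G.Adj u v ∧ G.degree u ≠ 1 ∧ G.degree v ≠ 1)

/-- The number of vertices of degree at least 2. -/
noncomputable def twoPlusCount {W : Type} [Fintype W] (H : SimpleGraph W) : ℕ :=
  (Finset.univ.filter (fun v : W => 2 ≤ H.degree v)).card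

/-- A graph with maximum average degree less than `8/3` and maximum degree at most `Δ`. -/
def GoodA (Δ : ℕ) {W : Type} [Fintype W] (H : SimpleGraph W) : Prop :=
  mad H < 8 / 3 ∧ H.maxDegree ≤ Δ

/-- `G` is a minimal counterexample to the bound `χ'_s ≤ 3Δ - 3` for graphs with
`Mad < 8/3` and maximum degree at most `Δ`. -/
def MinCexA (Δ : ℕ) {V : Type} [Fintype V] (G : SimpleGraph V) : Prop :=
  GoodA Δ G ∧ ¬ HasStrongColoring G (3 * Δ - 3) ∧
    ∀ (W : Type) [Fintype W] (H : SimpleGraph W), GoodA Δ H →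
      (twoPlusCount H < twoPlusCount G ∨
        (twoPlusCount H = twoPlusCount G ∧ H.edgeSet.ncard < G.edgeSet.ncard)) →
      HasStrongColoring H (3 * Δ - 3)

/-- `u` is special: it has degree 2 in `G*` and a neighbor in `G*` of degree at least
`Δ - 1` in `G*`. -/
def Special (Δ : ℕ) {V : Type} [Fintype V] (G : SimpleGraph V) (u : V) : Prop :=
  (core G).degree u = 2 ∧ ∃ w, (core G).Adj u w ∧ Δ - 1 ≤ (core G).degree w

theorem core_adj {V : Type} [Fintype V] {G : SimpleGraph V} {y z : V} :
    (core G).Adj y z ↔ G.Adj y z ∧ G.degree y ≠ 1 ∧ G.degree z ≠ 1 := by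
  unfold core
  rw [SimpleGraph.fromRel_adj]
  constructor
  · rintro ⟨_, h | h⟩
    · exact h
    · exact ⟨h.1.symm, h.2.2, h.2.1⟩
  · intro h
    exact ⟨h.1.ne, Or.inl h⟩

theorem adj_degree_pos {V : Type} [Fintype V] {G : SimpleGraph V} {y z : V}
    (h : G.Adj y z) : 1 ≤ G.degree y := by
  have := (G.degree_pos_iff_exists_adj y).2 ⟨z, h⟩
  exact this

theorem core_adj' {V : Type} [Fintype V] {G : SimpleGraph V} {y z : V} :
    (core G).Adj y z ↔ G.Adj y z ∧ 2 ≤ G.degree y ∧ 2 ≤ G.degree z := by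
  rw [core_adj]
  constructor
  · rintro ⟨h, h1, h2⟩
    have := adj_degree_pos h
    have := adj_degree_pos h.symm
    exact ⟨h, by omega, by omega⟩
  · rintro ⟨h, h1, h2⟩
    exact ⟨h, by omega, by omega⟩

theorem two_le_degree {V : Type} [Fintype V] {G : SimpleGraph V} {y z z' : V}
    (h : G.Adj y z) (h' : G.Adj y z') (hne : z ≠ z') : 2 ≤ G.degree y := by
  have : ({z, z'} : Finset V).card ≤ (G.neighborFinset y).card := by
    apply Finset.card_le_card
    intro a ha
    simp only [Finset.mem_insert, Finset.mem_singleton] at ha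
    rcases ha with rfl | rfl <;> simpa
  rwa [Finset.card_pair hne, SimpleGraph.card_neighborFinset_eq_degree] at this

theorem extend_inj {α β : Type*} (t s : Finset α) (hst : s ⊆ t) (f : α → β) (D : Finset β)
    (hD : t.card ≤ D.card) (hmap : ∀ a ∈ s, f a ∈ D) (hinj : Set.InjOn f s) :
    ∃ g : α → β, (∀ a ∈ t, g a ∈ D) ∧ Set.InjOn g t ∧ ∀ a ∈ s, g a = f a := by
  have hi : s.image f ⊆ D := by
    intro b hb
    obtain ⟨a, ha, rfl⟩ := Finset.mem_image.1 hb
    exact hmap a ha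
  obtain ⟨D', h1, h2, h3⟩ := Finset.exists_subsuperset_card_eq hi
    (Finset.card_image_le.trans (Finset.card_le_card hst)) hD
  obtain ⟨g, hg⟩ := Set.MapsTo.exists_equiv_extend_of_card_eq (α := t) (t := D')
    (s := {a | (a : α) ∈ s}) (f := fun a => f a) (by simp [h3])
    (fun a ha => h1 (Finset.mem_image_of_mem f ha))
    (fun a ha b hb hab => Subtype.ext (hinj ha hb hab))
  refine ⟨fun a => if h : a ∈ t then g ⟨a, h⟩ else f a, ?_, ?_, ?_⟩
  · intro a ha
    simp only [ha, dif_pos]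
    exact h2 (g ⟨a, ha⟩).2
  · intro a ha b hb hab
    have ha' : a ∈ t := ha
    have hb' : b ∈ t := hb
    simp only [ha', hb', dif_pos] at hab
    have := g.injective (Subtype.ext hab)
    exact congrArg Subtype.val this
  · intro a ha
    simp only [hst ha, dif_pos]
    exact hg ⟨a, hst ha⟩ ha

/-- A strong coloring of `G` assembled from palettes on the core. -/
theorem assemble {V : Type} [Fintype V] (G : SimpleGraph V) {k : ℕ}
    (c : Sym2 V → Fin k) (D : V → Finset (Fin k))
    (hD : ∀ y, 2 ≤ G.degree y → G.degree y ≤ (D y).card)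
    (hm : ∀ y z, (core G).Adj y z → c s(y, z) ∈ D y)
    (hint : ∀ y z, (core G).Adj y z → ∀ p ∈ D y, p ∈ D z → p = c s(y, z))
    (hinj : ∀ y z z', (core G).Adj y z → (core G).Adj y z' → c s(y, z) = c s(y, z') → z = z') :
    HasStrongColoring G k := by
  have key : ∀ y, ∃ g : V → Fin k, 2 ≤ G.degree y → ((∀ a, G.Adj y a → g a ∈ D y) ∧
      (∀ a b, G.Adj y a → G.Adj y b → g a = g b → a = b) ∧
      ∀ a, (core G).Adj y a → g a = c s(y, a)) := by
    intro y
    by_cases hy : 2 ≤ G.degree y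
    · obtain ⟨g, g1, g2, g3⟩ := extend_inj (G.neighborFinset y) ((core G).neighborFinset y)
        (by intro a ha
            simp only [SimpleGraph.mem_neighborFinset] at ha ⊢
            exact (core_adj.1 ha).1)
        (fun a => c s(y, a)) (D y) (by simpa using hD y hy)
        (by intro a ha; exact hm y a (by simpa using ha))
        (by intro a ha b hb hab
            exact hinj y a b (by simpa using ha) (by simpa using hb) hab)
      refine ⟨g, fun _ => ⟨?_, ?_, ?_⟩⟩
      · intro a ha; exact g1 a (by simpa using ha)
      · intro a b ha hb hab; exact g2 (by simpa using ha) (by simpa using hb) hab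
      · intro a ha; exact g3 a (by simpa using ha)
    · exact ⟨fun a => c s(y, a), fun h => absurd h hy⟩
  choose col hcol using key
  let C : Sym2 V → Fin k := fun e =>
    if h : ∃ q : V × V, e = s(q.1, q.2) ∧ G.Adj q.1 q.2 ∧ 2 ≤ G.degree q.1 then
      col h.choose.1 h.choose.2 else c e
  have hC : ∀ y z, G.Adj y z → 2 ≤ G.degree y → C s(y, z) = col y z := by
    intro y z hyz hy
    have h : ∃ q : V × V, s(y, z) = s(q.1, q.2) ∧ G.Adj q.1 q.2 ∧ 2 ≤ G.degree q.1 :=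
      ⟨(y, z), rfl, hyz, hy⟩
    have e1 : C s(y, z) = col h.choose.1 h.choose.2 := dif_pos h
    obtain ⟨h1, h2, h3⟩ := h.choose_spec
    rw [e1]
    generalize h.choose = q at *
    rcases Sym2.eq_iff.1 h1 with ⟨ha, hb⟩ | ⟨ha, hb⟩
    · rw [ha, hb]
    · rw [← ha, ← hb]
      rw [← hb] at h3
      rw [(hcol z h3).2.2 y (core_adj'.2 ⟨hyz.symm, h3, hy⟩),
        (hcol y hy).2.2 z (core_adj'.2 ⟨hyz, hy, h3⟩), Sym2.eq_swap]
  have hCD : ∀ y, 2 ≤ G.degree y → ∀ e ∈ G.edgeSet, y ∈ e → C e ∈ D y := by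
    intro y hy e he hye
    obtain ⟨z, rfl⟩ := Sym2.mem_iff_exists.1 hye
    rw [hC y z he hy]
    exact (hcol y hy).1 z he
  have hCi : ∀ y, 2 ≤ G.degree y → ∀ e ∈ G.edgeSet, ∀ e' ∈ G.edgeSet, y ∈ e → y ∈ e' →
      C e = C e' → e = e' := by
    intro y hy e he e' he' hye hye' hee
    obtain ⟨z, rfl⟩ := Sym2.mem_iff_exists.1 hye
    obtain ⟨z', rfl⟩ := Sym2.mem_iff_exists.1 hye'
    rw [hC y z he hy, hC y z' he' hy] at hee
    rw [(hcol y hy).2.1 z z' he he' hee]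
  have hdeg : ∀ y, ∀ e ∈ G.edgeSet, ∀ e' ∈ G.edgeSet, y ∈ e → y ∈ e' → e ≠ e' →
      2 ≤ G.degree y := by
    intro y e he e' he' hye hye' hne
    obtain ⟨z, rfl⟩ := Sym2.mem_iff_exists.1 hye
    obtain ⟨z', rfl⟩ := Sym2.mem_iff_exists.1 hye'
    exact two_le_degree (z := z) (z' := z') he he' (fun h => hne (by rw [h]))
  refine ⟨C, ?_⟩
  rintro e he e' he' ⟨hne, hcon⟩ heq
  have hno : ¬ ∃ v, v ∈ e ∧ v ∈ e' := by
    rintro ⟨v, hv, hv'⟩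
    exact hne (hCi v (hdeg v e he e' he' hv hv' hne) e he e' he' hv hv' heq)
  rcases hcon with h | ⟨f, hf, ⟨v, hv, hvf⟩, ⟨w, hw, hwf⟩⟩
  · exact hno h
  have hvw : v ≠ w := fun h => hno ⟨v, hv, h ▸ hw⟩
  have hfe : f = s(v, w) := ((Sym2.mem_and_mem_iff hvw).1 ⟨hvf, hwf⟩)
  subst hfe
  have hef : e ≠ s(v, w) := fun h => hno ⟨w, by rw [h]; exact hwf, hw⟩
  have hef' : e' ≠ s(v, w) := fun h => hno ⟨v, hv, by rw [h]; exact hvf⟩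
  have dv := hdeg v e he _ hf hv hvf hef
  have dw := hdeg w e' he' _ hf hw hwf hef'
  have hcore : (core G).Adj v w := core_adj'.2 ⟨hf, dv, dw⟩
  have h1 := hint v w hcore (C e) (hCD v dv e he hv) (heq ▸ hCD w dw e' he' hw)
  have h2 : C s(v, w) = c s(v, w) := by
    rw [hC v w hf dv, (hcol v dv).2.2 w hcore]
  exact hef (hCi v dv e he _ hf hv hvf (h1.trans h2.symm))

theorem mad_bdd {V : Type} [Fintype V] (G : SimpleGraph V) :
    {x : ℝ | ∃ A : Finset V, A.Nonempty ∧
      x = 2 * ({e ∈ G.edgeSet | ∀ v ∈ e, v ∈ A}.ncard : ℝ) / (A.card : ℝ)}.Finite := by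
  apply (Set.finite_range (fun A : Finset V =>
    2 * ({e ∈ G.edgeSet | ∀ v ∈ e, v ∈ A}.ncard : ℝ) / (A.card : ℝ))).subset
  rintro x ⟨A, _, rfl⟩
  exact ⟨A, rfl⟩

theorem mad_lt_imp {V : Type} [Fintype V] (G : SimpleGraph V) (h : mad G < 8 / 3)
    (A : Finset V) (hA : A.Nonempty) :
    3 * {e ∈ G.edgeSet | ∀ v ∈ e, v ∈ A}.ncard < 4 * A.card := by
  have h1 := le_csSup (mad_bdd G).bddAbove ⟨A, hA, rfl⟩
  have h2 := lt_of_le_of_lt h1 h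
  have hc : (0 : ℝ) < A.card := by exact_mod_cast hA.card_pos
  rw [div_lt_iff₀ hc] at h2
  have : (3 * {e ∈ G.edgeSet | ∀ v ∈ e, v ∈ A}.ncard : ℝ) < 4 * A.card := by linarith
  exact_mod_cast this

theorem mad_lt_of {V : Type} [Fintype V] (G : SimpleGraph V)
    (h : ∀ A : Finset V, A.Nonempty →
      3 * {e ∈ G.edgeSet | ∀ v ∈ e, v ∈ A}.ncard < 4 * A.card) : mad G < 8 / 3 := by
  unfold mad
  rcases Set.eq_empty_or_nonempty {x : ℝ | ∃ A : Finset V, A.Nonempty ∧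
      x = 2 * ({e ∈ G.edgeSet | ∀ v ∈ e, v ∈ A}.ncard : ℝ) / (A.card : ℝ)} with he | hne
  · rw [he, Real.sSup_empty]; norm_num
  · rw [(mad_bdd G).csSup_lt_iff hne]
    rintro x ⟨A, hA, rfl⟩
    have hc : (0 : ℝ) < A.card := by exact_mod_cast hA.card_pos
    rw [div_lt_iff₀ hc]
    have : (3 * {e ∈ G.edgeSet | ∀ v ∈ e, v ∈ A}.ncard : ℝ) < 4 * A.card := by
      exact_mod_cast h A hA
    linarith

/-- Adjacency relation of the padded graph. -/
def padAdj {V : Type} (K : SimpleGraph V) (t : V → ℕ) (n : ℕ) :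
    V ⊕ (V × Fin n) → V ⊕ (V × Fin n) → Prop
  | Sum.inl y, Sum.inl z => K.Adj y z
  | Sum.inl y, Sum.inr q => q.1 = y ∧ (q.2 : ℕ) < t y
  | Sum.inr q, Sum.inl y => q.1 = y ∧ (q.2 : ℕ) < t y
  | Sum.inr _, Sum.inr _ => False

/-- The graph `K` with `t y` pendant vertices attached to each vertex `y`. -/
def pad {V : Type} (K : SimpleGraph V) (t : V → ℕ) (n : ℕ) :
    SimpleGraph (V ⊕ (V × Fin n)) where
  Adj := padAdj K t n
  symm := ⟨by
    rintro (y | q) (z | r) h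
    · exact SimpleGraph.Adj.symm (G := K) h
    · exact h
    · exact h
    · exact h⟩
  loopless := ⟨by
    rintro (y | q) h
    · exact K.loopless.irrefl y h
    · exact h⟩

theorem pad_degree_inl {V : Type} [Fintype V] (K : SimpleGraph V) (t : V → ℕ) (n : ℕ) (y : V)
    (ht : t y ≤ n) : (pad K t n).degree (Sum.inl y) = K.degree y + t y := by
  have : (pad K t n).neighborFinset (Sum.inl y) = (K.neighborFinset y).disjSum
      ((Finset.univ.filter (fun j : Fin n => (j : ℕ) < t y)).map
        ⟨fun j => (y, j), fun a b h => (Prod.ext_iff.1 h).2⟩) := by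
    ext a
    rcases a with z | ⟨z, j⟩
    · simp only [SimpleGraph.mem_neighborFinset, Finset.inl_mem_disjSum]
      rfl
    · simp only [SimpleGraph.mem_neighborFinset, Finset.inr_mem_disjSum, Finset.mem_map,
        Finset.mem_filter, Finset.mem_univ, true_and]
      change (z = y ∧ (j : ℕ) < t y) ↔ _
      constructor
      · rintro ⟨rfl, h⟩
        exact ⟨j, h, rfl⟩
      · rintro ⟨j', h, h'⟩
        obtain ⟨h1, h2⟩ := Prod.ext_iff.1 h'
        simp only at h1 h2
        subst h1 h2
        exact ⟨rfl, h⟩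
  rw [← SimpleGraph.card_neighborFinset_eq_degree, this, Finset.card_disjSum, Finset.card_map,
    SimpleGraph.card_neighborFinset_eq_degree, Fin.card_filter_val_lt, min_eq_right ht]

theorem pad_degree_inr {V : Type} [Fintype V] (K : SimpleGraph V) (t : V → ℕ) (n : ℕ)
    (q : V × Fin n) : (pad K t n).degree (Sum.inr q) ≤ 1 := by
  rw [← SimpleGraph.card_neighborFinset_eq_degree]
  apply (Finset.card_le_card (t := {Sum.inl q.1}) ?_).trans
  · simp
  · intro a ha
    rw [SimpleGraph.mem_neighborFinset] at ha
    rcases a with z | r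
    · have h : q.1 = z ∧ (q.2 : ℕ) < t z := ha
      simp [h.1]
    · exact absurd ha (fun h => h)

theorem pad_mad {V : Type} [Fintype V] (G K : SimpleGraph V) (hK : K ≤ G) (h : mad G < 8 / 3)
    (t : V → ℕ) (n : ℕ) : mad (pad K t n) < 8 / 3 := by
  apply mad_lt_of
  intro A hA
  have hsub : {e ∈ (pad K t n).edgeSet | ∀ v ∈ e, v ∈ A} ⊆
      (Sym2.map Sum.inl '' {e ∈ G.edgeSet | ∀ v ∈ e, v ∈ A.toLeft}) ∪
      ((fun q : V × Fin n => s(Sum.inl q.1, Sum.inr q)) '' (A.toRight : Set (V × Fin n))) := by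
    rintro e ⟨he, heA⟩
    induction e using Sym2.ind with
    | _ a b =>
    rw [SimpleGraph.mem_edgeSet] at he
    rcases a with y | q <;> rcases b with z | r
    · left
      have he' : K.Adj y z := he
      refine ⟨s(y, z), ⟨hK he', ?_⟩, by simp⟩
      intro v hv
      rw [Finset.mem_toLeft]
      rcases Sym2.mem_iff.1 hv with rfl | rfl
      · exact heA _ (Sym2.mem_mk_left _ _)
      · exact heA _ (Sym2.mem_mk_right _ _)
    · right
      have he' : r.1 = y ∧ (r.2 : ℕ) < t y := he
      refine ⟨r, ?_, by simp [he'.1]⟩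
      rw [Finset.mem_coe, Finset.mem_toRight]
      exact heA _ (Sym2.mem_mk_right _ _)
    · right
      have he' : q.1 = z ∧ (q.2 : ℕ) < t z := he
      refine ⟨q, ?_, by simp [he'.1, Sym2.eq_swap]⟩
      rw [Finset.mem_coe, Finset.mem_toRight]
      exact heA _ (Sym2.mem_mk_left _ _)
    · exact absurd he (fun h => h)
  have h1 := (Set.ncard_le_ncard hsub (Set.toFinite _)).trans (Set.ncard_union_le _ _)
  have h2 := Set.ncard_image_le (f := Sym2.map (Sum.inl : V → V ⊕ (V × Fin n)))
    (s := {e ∈ G.edgeSet | ∀ v ∈ e, v ∈ A.toLeft}) (Set.toFinite _)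
  have h3 := Set.ncard_image_le (f := fun q : V × Fin n =>
    (s(Sum.inl q.1, Sum.inr q) : Sym2 (V ⊕ (V × Fin n))))
    (s := (A.toRight : Set (V × Fin n))) (Set.toFinite _)
  rw [Set.ncard_coe_finset] at h3
  have h4 : A.toLeft.card + A.toRight.card = A.card := Finset.card_toLeft_add_card_toRight
  have h5 := hA.card_pos
  rcases A.toLeft.eq_empty_or_nonempty with h0 | hne
  · have : {e ∈ G.edgeSet | ∀ v ∈ e, v ∈ A.toLeft} = ∅ := by
      rw [h0]
      ext e
      simp only [Set.mem_ofPred_eq, Set.mem_empty_iff_false, iff_false, not_and]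
      intro _ hh
      induction e using Sym2.ind with
      | _ a b => exact absurd (hh a (Sym2.mem_mk_left _ _)) (by simp)
    have hz : {e ∈ G.edgeSet | ∀ v ∈ e, v ∈ A.toLeft}.ncard = 0 := by
      rw [this, Set.ncard_empty]
    omega
  · have := mad_lt_imp G h _ hne
    omega

/-- Palettes obtained by coloring a padded subgraph. -/
theorem palettes {V : Type} [Fintype V] {Δ : ℕ} (hΔ : 1 ≤ Δ) {G : SimpleGraph V}
    (hG : MinCexA Δ G)
    (K : SimpleGraph V) (hK : K ≤ G) (S : Finset V)
    (hS : S.card < twoPlusCount G) (hS1 : ∀ y, y ∉ S → K.degree y ≤ 1) :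
    ∃ (c : Sym2 V → Fin (3 * Δ - 3)) (D : V → Finset (Fin (3 * Δ - 3))),
      (∀ y ∈ S, (D y).card = Δ) ∧
      (∀ y z, K.Adj y z → c s(y, z) ∈ D y) ∧
      (∀ y z, K.Adj y z → ∀ p ∈ D y, p ∈ D z → p = c s(y, z)) ∧
      (∀ y z z', K.Adj y z → K.Adj y z' → c s(y, z) = c s(y, z') → z = z') := by
  obtain ⟨⟨hmad, hmax⟩, -, hmin⟩ := hG
  have hKd : ∀ y, K.degree y ≤ Δ := fun y =>
    (SimpleGraph.degree_le_of_le hK).trans ((G.degree_le_maxDegree y).trans hmax)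
  let t : V → ℕ := fun y => if y ∈ S then Δ - K.degree y else 0
  have htle : ∀ y, t y ≤ Δ := by
    intro y; simp only [t]; split_ifs <;> omega
  have hd1 : ∀ y ∈ S, (pad K t Δ).degree (Sum.inl y) = Δ := by
    intro y hy
    rw [pad_degree_inl K t Δ y (htle y)]
    simp only [t, hy, if_true]
    have := hKd y
    omega
  have hd2 : ∀ y, y ∉ S → (pad K t Δ).degree (Sum.inl y) ≤ 1 := by
    intro y hy
    rw [pad_degree_inl K t Δ y (htle y)]
    simp only [t, hy, if_false]
    exact hS1 y hy
  have hgood : GoodA Δ (pad K t Δ) := by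
    refine ⟨pad_mad G K hK hmad t Δ, ?_⟩
    apply SimpleGraph.maxDegree_le_of_forall_degree_le
    rintro (y | q)
    · by_cases hy : y ∈ S
      · rw [hd1 y hy]
      · exact (hd2 y hy).trans hΔ
    · exact (pad_degree_inr K t Δ q).trans hΔ
  have hcount : twoPlusCount (pad K t Δ) < twoPlusCount G := by
    refine lt_of_le_of_lt ?_ hS
    unfold twoPlusCount
    rw [← Finset.card_map (Function.Embedding.inl (α := V) (β := V × Fin Δ)) (s := S)]
    apply Finset.card_le_card
    intro a ha
    rw [Finset.mem_filter] at ha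
    rcases a with y | q
    · by_cases hy : y ∈ S
      · exact Finset.mem_map.2 ⟨y, hy, rfl⟩
      · have := hd2 y hy
        omega
    · have := pad_degree_inr K t Δ q
      omega
  obtain ⟨C, hC⟩ := hmin _ (pad K t Δ) hgood (Or.inl hcount)
  have hshare : ∀ y a b, (pad K t Δ).Adj y a → (pad K t Δ).Adj y b →
      C s(y, a) = C s(y, b) → a = b := by
    intro y a b ha hb hab
    by_contra hne
    refine hC s(y, a) ha s(y, b) hb ⟨?_, Or.inl ⟨y, by simp, by simp⟩⟩ hab
    intro h
    exact hne (Sym2.congr_right.1 h)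
  refine ⟨fun e => C (e.map Sum.inl),
    fun y => ((pad K t Δ).neighborFinset (Sum.inl y)).image (fun b => C s(Sum.inl y, b)),
    ?_, ?_, ?_, ?_⟩
  · intro y hy
    rw [Finset.card_image_of_injOn, SimpleGraph.card_neighborFinset_eq_degree, hd1 y hy]
    intro a ha b hb hab
    exact hshare _ a b (by simpa using ha) (by simpa using hb) hab
  · intro y z hyz
    refine Finset.mem_image.2 ⟨Sum.inl z, ?_, by simp⟩
    rw [SimpleGraph.mem_neighborFinset]
    exact hyz
  · intro y z hyz p hp hp'
    obtain ⟨a, ha, rfl⟩ := Finset.mem_image.1 hp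
    obtain ⟨b, hb, hab⟩ := Finset.mem_image.1 hp'
    rw [SimpleGraph.mem_neighborFinset] at ha hb
    have hadj : (pad K t Δ).Adj (Sum.inl y) (Sum.inl z) := hyz
    by_cases hee : s(Sum.inl y, a) = s(Sum.inl z, b)
    · have hz : (Sum.inl z : V ⊕ (V × Fin Δ)) ∈ s(Sum.inl y, a) := by rw [hee]; simp
      rcases Sym2.mem_iff.1 hz with h | h
      · exact absurd (Sum.inl_injective h).symm hyz.ne
      · rw [← h]; simp
    · exfalso
      refine hC _ ha _ hb ⟨hee, Or.inr ⟨s(Sum.inl y, Sum.inl z), hadj, ?_, ?_⟩⟩ hab.symm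
      · exact ⟨Sum.inl y, by simp, by simp⟩
      · exact ⟨Sum.inl z, by simp, by simp⟩
  · intro y z z' hz hz' h
    have := hshare (Sum.inl y) (Sum.inl z) (Sum.inl z') hz hz' (by simpa using h)
    exact Sum.inl_injective this

theorem exists_not_mem {k : ℕ} (F : Finset (Fin k)) (h : F.card < k) : ∃ p, p ∉ F := by
  by_contra hcon
  push Not at hcon
  have : F = Finset.univ := Finset.eq_univ_iff_forall.2 hcon
  rw [this, Finset.card_univ, Fintype.card_fin] at h
  exact lt_irrefl _ h

theorem exists_mem_not_mem {α : Type*} (A F : Finset α) (h : F.card < A.card) :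
    ∃ p ∈ A, p ∉ F := by
  by_contra hcon
  push Not at hcon
  have := Finset.card_le_card (show A ⊆ F from hcon)
  omega

theorem palette_mid {Δ : ℕ} (hΔ : 9 ≤ Δ) (D U : Finset (Fin (3 * Δ - 3))) (hD : D.card = Δ)
    (hU : U.card = Δ) (a b d : Fin (3 * Δ - 3)) (hd : d ∈ D) (hd' : d ∈ U)
    (ha : a ∈ D) (ha' : a ∉ U) (hb : b ∈ U) (hb' : b ∉ D) :
    ∃ P : Finset (Fin (3 * Δ - 3)), P.card = Δ ∧ a ∈ P ∧ b ∈ P ∧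
      (∀ p ∈ P, p ∈ D → p = a) ∧ (∀ p ∈ P, p ∈ U → p = b) := by
  have hab : a ≠ b := fun h => hb' (h ▸ ha)
  have h1 : (D ∪ U).card + (D ∩ U).card = D.card + U.card := Finset.card_union_add_card_inter D U
  have h2 : 1 ≤ (D ∩ U).card := Finset.card_pos.2 ⟨d, Finset.mem_inter.2 ⟨hd, hd'⟩⟩
  have h3 : (D ∪ U)ᶜ.card = 3 * Δ - 3 - (D ∪ U).card := by
    rw [Finset.card_compl, Fintype.card_fin]
  have h4 : (({a, b} : Finset (Fin (3 * Δ - 3))) ∪ (D ∪ U)ᶜ).card = 2 + (D ∪ U)ᶜ.card := by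
    rw [Finset.card_union_of_disjoint, Finset.card_pair hab]
    rw [Finset.disjoint_left]
    intro p hp hp'
    simp only [Finset.mem_insert, Finset.mem_singleton] at hp
    simp only [Finset.mem_compl, Finset.mem_union, not_or] at hp'
    rcases hp with rfl | rfl
    · exact hp'.1 ha
    · exact hp'.2 hb
  obtain ⟨P, hP1, hP2, hP3⟩ := Finset.exists_subsuperset_card_eq (n := Δ)
    (Finset.subset_union_left (s₁ := ({a, b} : Finset (Fin (3 * Δ - 3)))) (s₂ := (D ∪ U)ᶜ))
    (by rw [Finset.card_pair hab]; omega) (by omega)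
  refine ⟨P, hP3, hP1 (by simp), hP1 (by simp), ?_, ?_⟩
  · intro p hp hpD
    have := hP2 hp
    simp only [Finset.mem_union, Finset.mem_insert, Finset.mem_singleton, Finset.mem_compl,
      not_or] at this
    rcases this with (h | h) | h
    · exact h
    · exact absurd (h ▸ hpD) hb'
    · exact absurd hpD h.1
  · intro p hp hpU
    have := hP2 hp
    simp only [Finset.mem_union, Finset.mem_insert, Finset.mem_singleton, Finset.mem_compl,
      not_or] at this
    rcases this with (h | h) | h
    · exact absurd (h ▸ hpU) ha'
    · exact h
    · exact absurd hpU h.2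

theorem pick_d {Δ : ℕ} {α : Type*} (X D : Finset α) (hX : X.card = Δ) (hD : D.card = Δ) (c0 : α)
    (hc : c0 ∈ X) : ∃ d ∈ D, (d = c0 ∨ (d ∉ X ∧ c0 ∉ D)) := by
  by_cases h : c0 ∈ D
  · exact ⟨c0, h, Or.inl rfl⟩
  · have h1 : (X.erase c0).card < D.card := by
      rw [Finset.card_erase_of_mem hc]
      have : 0 < X.card := Finset.card_pos.2 ⟨c0, hc⟩
      omega
    obtain ⟨d, hd, hd'⟩ := exists_mem_not_mem D _ h1
    refine ⟨d, hd, Or.inr ⟨?_, h⟩⟩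
    intro hdX
    exact hd' (Finset.mem_erase.2 ⟨fun h' => h (h' ▸ hd), hdX⟩)

theorem pick_a {α : Type*} (A D : Finset α) (hA : A ⊆ D) (c0 d d' : α)
    (hd : d = c0 ∨ c0 ∉ D) (F : Finset α) (hF : F.card + 2 < A.card) :
    ∃ a ∈ A, a ≠ c0 ∧ a ≠ d ∧ a ≠ d' ∧ a ∉ F := by
  obtain ⟨a, ha, ha'⟩ := exists_mem_not_mem A (F ∪ {d, d'}) (by
    have h1 := Finset.card_union_le F {d, d'}
    have h2 := Finset.card_le_two (a := d) (b := d')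
    omega)
  simp only [Finset.mem_union, Finset.mem_insert, Finset.mem_singleton, not_or] at ha'
  refine ⟨a, ha, ?_, ha'.2.1, ha'.2.2, ha'.1⟩
  rcases hd with h | h
  · rw [← h]; exact ha'.2.1
  · intro h'; exact h (h' ▸ hA ha)

theorem set_problem {Δ : ℕ} (hΔ : 9 ≤ Δ) (X D₁ D₂ A₁ A₂ : Finset (Fin (3 * Δ - 3)))
    (c0 : Fin (3 * Δ - 3)) (hX : X.card = Δ) (hD₁ : D₁.card = Δ) (hD₂ : D₂.card = Δ)
    (hc : c0 ∈ X) (hA₁ : A₁ ⊆ D₁) (hA₂ : A₂ ⊆ D₂) (h3₁ : 3 ≤ A₁.card) (h3₂ : 3 ≤ A₂.card)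
    (E : Prop) (hE : E → 4 ≤ A₂.card) :
    ∃ (a₁ a₂ b₁ b₂ : Fin (3 * Δ - 3)) (U P₁ P₂ : Finset (Fin (3 * Δ - 3))),
      a₁ ∈ A₁ ∧ a₂ ∈ A₂ ∧ (E → a₁ ≠ a₂) ∧ U.card = Δ ∧ P₁.card = Δ ∧ P₂.card = Δ ∧
      c0 ∈ U ∧ b₁ ∈ U ∧ b₂ ∈ U ∧ b₁ ≠ b₂ ∧ c0 ≠ b₁ ∧ c0 ≠ b₂ ∧ a₁ ≠ b₁ ∧ a₂ ≠ b₂ ∧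
      (∀ p ∈ U, p ∈ X → p = c0) ∧ a₁ ∈ P₁ ∧ b₁ ∈ P₁ ∧ a₂ ∈ P₂ ∧ b₂ ∈ P₂ ∧
      (∀ p ∈ P₁, p ∈ D₁ → p = a₁) ∧ (∀ p ∈ P₁, p ∈ U → p = b₁) ∧
      (∀ p ∈ P₂, p ∈ D₂ → p = a₂) ∧ (∀ p ∈ P₂, p ∈ U → p = b₂) := by
  obtain ⟨d₁, hd₁, hd₁'⟩ := pick_d X D₁ hX hD₁ c0 hc
  obtain ⟨d₂, hd₂, hd₂'⟩ := pick_d X D₂ hX hD₂ c0 hc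
  obtain ⟨a₁, ha₁, ha₁c, ha₁d, ha₁d', -⟩ := pick_a A₁ D₁ hA₁ c0 d₁ d₂
    (hd₁'.imp_right And.right) ∅ (by simp; omega)
  obtain ⟨a₂, ha₂, ha₂c, ha₂d, ha₂d', haa⟩ := pick_a A₂ D₂ hA₂ c0 d₂ d₁
    (hd₂'.imp_right And.right) (if E then {a₁} else ∅) (by
      split_ifs with h
      · have := hE h
        rw [Finset.card_singleton]; omega
      · rw [Finset.card_empty]; omega)
  obtain ⟨b₁, hb₁⟩ := exists_not_mem (D₁ ∪ X ∪ {a₁, a₂}) (by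
    have h1 := Finset.card_union_le (D₁ ∪ X) {a₁, a₂}
    have h2 := Finset.card_le_two (a := a₁) (b := a₂)
    have h3 := Finset.card_union_le D₁ X
    omega)
  obtain ⟨b₂, hb₂⟩ := exists_not_mem (D₂ ∪ X ∪ {a₁, a₂} ∪ {b₁}) (by
    have h0 := Finset.card_union_le (D₂ ∪ X ∪ {a₁, a₂}) {b₁}
    have h1 := Finset.card_union_le (D₂ ∪ X) {a₁, a₂}
    have h2 := Finset.card_le_two (a := a₁) (b := a₂)
    have h3 := Finset.card_union_le D₂ X
    rw [Finset.card_singleton] at h0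
    omega)
  simp only [Finset.mem_union, Finset.mem_insert, Finset.mem_singleton, not_or] at hb₁ hb₂
  obtain ⟨⟨hb₁D, hb₁X⟩, hb₁a, hb₁a'⟩ := hb₁
  obtain ⟨⟨⟨hb₂D, hb₂X⟩, hb₂a, hb₂a'⟩, hbb⟩ := hb₂
  let Z : Finset (Fin (3 * Δ - 3)) := {c0} ∪ (X ∪ {a₁, a₂})ᶜ
  have hZ : ({c0, b₁, b₂, d₁, d₂} : Finset (Fin (3 * Δ - 3))) ⊆ Z := by
    intro p hp
    simp only [Finset.mem_insert, Finset.mem_singleton] at hp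
    simp only [Z, Finset.mem_union, Finset.mem_insert, Finset.mem_singleton, Finset.mem_compl,
      not_or]
    rcases hp with rfl | rfl | rfl | rfl | rfl
    · exact Or.inl rfl
    · exact Or.inr ⟨hb₁X, hb₁a, hb₁a'⟩
    · exact Or.inr ⟨hb₂X, hb₂a, hb₂a'⟩
    · rcases hd₁' with h | h
      · exact Or.inl h
      · exact Or.inr ⟨h.1, ha₁d.symm, ha₂d'.symm⟩
    · rcases hd₂' with h | h
      · exact Or.inl h
      · exact Or.inr ⟨h.1, ha₁d'.symm, ha₂d.symm⟩
  have hZc : Δ ≤ Z.card := by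
    have h1 : (X ∪ {a₁, a₂})ᶜ.card ≤ Z.card := Finset.card_le_card Finset.subset_union_right
    rw [Finset.card_compl, Fintype.card_fin] at h1
    have h2 := Finset.card_le_two (a := a₁) (b := a₂)
    have h3 := Finset.card_union_le X {a₁, a₂}
    omega
  obtain ⟨U, hU1, hU2, hU3⟩ := Finset.exists_subsuperset_card_eq (n := Δ) hZ
    (Finset.card_le_five.trans (by omega)) hZc
  have hUX : ∀ p ∈ U, p ∈ X → p = c0 := by
    intro p hp hpX
    have := hU2 hp
    simp only [Z, Finset.mem_union, Finset.mem_singleton, Finset.mem_compl, not_or] at this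
    rcases this with h | h
    · exact h
    · exact absurd hpX h.1
  have hUa : ∀ p ∈ U, p ≠ a₁ ∧ p ≠ a₂ := by
    intro p hp
    have := hU2 hp
    simp only [Z, Finset.mem_union, Finset.mem_insert, Finset.mem_singleton, Finset.mem_compl,
      not_or] at this
    rcases this with h | h
    · rw [h]; exact ⟨ha₁c.symm, ha₂c.symm⟩
    · exact h.2
  obtain ⟨P₁, q1, q2, q3, q4, q5⟩ := palette_mid hΔ D₁ U hD₁ hU3 a₁ b₁ d₁ hd₁ (hU1 (by simp))
    (hA₁ ha₁) (fun h => (hUa _ h).1 rfl) (hU1 (by simp)) hb₁D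
  obtain ⟨P₂, r1, r2, r3, r4, r5⟩ := palette_mid hΔ D₂ U hD₂ hU3 a₂ b₂ d₂ hd₂ (hU1 (by simp))
    (hA₂ ha₂) (fun h => (hUa _ h).2 rfl) (hU1 (by simp)) hb₂D
  refine ⟨a₁, a₂, b₁, b₂, U, P₁, P₂, ha₁, ha₂, ?_, hU3, q1, r1, hU1 (by simp), hU1 (by simp),
    hU1 (by simp), fun h => hbb h.symm, ?_, ?_, fun h => hb₁a h.symm, fun h => hb₂a' h.symm, hUX,
    q2, q3, r2, r3, q4, q5, r4, r5⟩
  · intro h h'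
    rw [if_pos h, Finset.mem_singleton] at haa
    exact haa h'.symm
  · intro h; exact hb₁X (h ▸ hc)
  · intro h; exact hb₂X (h ▸ hc)

theorem set_problem_triangle {Δ : ℕ} (hΔ : 9 ≤ Δ) (X : Finset (Fin (3 * Δ - 3)))
    (c0 : Fin (3 * Δ - 3)) (hX : X.card = Δ) (hc : c0 ∈ X) :
    ∃ (a b₁ b₂ : Fin (3 * Δ - 3)) (U P₁ P₂ : Finset (Fin (3 * Δ - 3))),
      U.card = Δ ∧ P₁.card = Δ ∧ P₂.card = Δ ∧
      c0 ∈ U ∧ b₁ ∈ U ∧ b₂ ∈ U ∧ b₁ ≠ b₂ ∧ c0 ≠ b₁ ∧ c0 ≠ b₂ ∧ a ≠ b₁ ∧ a ≠ b₂ ∧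
      (∀ p ∈ U, p ∈ X → p = c0) ∧ a ∈ P₁ ∧ b₁ ∈ P₁ ∧ a ∈ P₂ ∧ b₂ ∈ P₂ ∧
      (∀ p ∈ P₁, p ∈ P₂ → p = a) ∧ (∀ p ∈ P₁, p ∈ U → p = b₁) ∧
      (∀ p ∈ P₂, p ∈ U → p = b₂) := by
  have hXc : Xᶜ.card = 3 * Δ - 3 - Δ := by rw [Finset.card_compl, Fintype.card_fin, hX]
  obtain ⟨T, hT1, hT2⟩ := Finset.exists_subset_card_eq (s := Xᶜ) (n := Δ - 1) (by omega)
  have hc0T : c0 ∉ T := fun h => (Finset.mem_compl.1 (hT1 h)) hc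
  obtain ⟨b₁, hb₁, b₂, hb₂, hbb⟩ := Finset.one_lt_card.1 (show 1 < T.card by omega)
  have hUc : (insert c0 T).card = Δ := by
    rw [Finset.card_insert_of_notMem hc0T, hT2]; omega
  have hUcc : (insert c0 T)ᶜ.card = 3 * Δ - 3 - Δ := by
    rw [Finset.card_compl, Fintype.card_fin, hUc]
  obtain ⟨a, ha⟩ := Finset.card_pos.1 (show 0 < (insert c0 T)ᶜ.card by omega)
  have haU := Finset.mem_compl.1 ha
  have hR : ((insert c0 T)ᶜ.erase a).card = 3 * Δ - 3 - Δ - 1 := by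
    rw [Finset.card_erase_of_mem ha, hUcc]
  obtain ⟨Q₁, hQ1, hQ2⟩ := Finset.exists_subset_card_eq
    (s := (insert c0 T)ᶜ.erase a) (n := Δ - 2) (by omega)
  have hR2 : (((insert c0 T)ᶜ.erase a) \ Q₁).card = 3 * Δ - 3 - Δ - 1 - (Δ - 2) := by
    rw [Finset.card_sdiff_of_subset hQ1, hR, hQ2]
  obtain ⟨Q₂, hQ3, hQ4⟩ := Finset.exists_subset_card_eq
    (s := ((insert c0 T)ᶜ.erase a) \ Q₁) (n := Δ - 2) (by omega)
  have hQ₁ : ∀ p ∈ Q₁, p ≠ a ∧ p ∉ insert c0 T := by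
    intro p hp
    have := Finset.mem_erase.1 (hQ1 hp)
    exact ⟨this.1, Finset.mem_compl.1 this.2⟩
  have hQ₂ : ∀ p ∈ Q₂, p ≠ a ∧ p ∉ insert c0 T ∧ p ∉ Q₁ := by
    intro p hp
    have h0 := Finset.mem_sdiff.1 (hQ3 hp)
    have := Finset.mem_erase.1 h0.1
    exact ⟨this.1, Finset.mem_compl.1 this.2, h0.2⟩
  have hb₁U : b₁ ∈ insert c0 T := Finset.mem_insert_of_mem hb₁
  have hb₂U : b₂ ∈ insert c0 T := Finset.mem_insert_of_mem hb₂
  have hab₁ : a ≠ b₁ := fun h => haU (h ▸ hb₁U)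
  have hab₂ : a ≠ b₂ := fun h => haU (h ▸ hb₂U)
  refine ⟨a, b₁, b₂, insert c0 T, insert a (insert b₁ Q₁), insert a (insert b₂ Q₂), hUc, ?_, ?_,
    by simp, hb₁U, hb₂U, hbb, fun h => hc0T (h ▸ hb₁), fun h => hc0T (h ▸ hb₂), hab₁, hab₂,
    ?_, by simp, by simp, by simp, by simp, ?_, ?_, ?_⟩
  · rw [Finset.card_insert_of_notMem, Finset.card_insert_of_notMem, hQ2]
    · omega
    · exact fun h => (hQ₁ _ h).2 hb₁U
    · rw [Finset.mem_insert]
      rintro (h | h)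
      · exact hab₁ h
      · exact (hQ₁ _ h).1 rfl
  · rw [Finset.card_insert_of_notMem, Finset.card_insert_of_notMem, hQ4]
    · omega
    · exact fun h => (hQ₂ _ h).2.1 hb₂U
    · rw [Finset.mem_insert]
      rintro (h | h)
      · exact hab₂ h
      · exact (hQ₂ _ h).1 rfl
  · intro p hp hpX
    rcases Finset.mem_insert.1 hp with h | h
    · exact h
    · exact absurd hpX (Finset.mem_compl.1 (hT1 h))
  · intro p hp hp'
    rw [Finset.mem_insert, Finset.mem_insert] at hp hp'
    rcases hp with h | rfl | h
    · exact h
    · rcases hp' with h' | h' | h'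
      · exact h'
      · exact absurd h' hbb
      · exact absurd hb₁U (hQ₂ _ h').2.1
    · rcases hp' with h' | rfl | h'
      · exact h'
      · exact absurd hb₂U (hQ₁ _ h).2
      · exact absurd h (hQ₂ _ h').2.2
  · intro p hp hpU
    rw [Finset.mem_insert, Finset.mem_insert] at hp
    rcases hp with rfl | h | h
    · exact absurd hpU haU
    · exact h
    · exact absurd hpU (hQ₁ _ h).2
  · intro p hp hpU
    rw [Finset.mem_insert, Finset.mem_insert] at hp
    rcases hp with rfl | h | h
    · exact absurd hpU haU
    · exact h
    · exact absurd hpU (hQ₂ _ h).2.1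

theorem finish {V : Type} [Fintype V] (G K : SimpleGraph V) {k Δ : ℕ}
    (hmax : ∀ y, G.degree y ≤ Δ) (u v₁ v₂ x w₁ w₂ : V)
    (hK : ∀ y z, K.Adj y z ↔ (core G).Adj y z ∧ y ≠ v₁ ∧ y ≠ v₂ ∧ z ≠ v₁ ∧ z ≠ v₂)
    (huv₁ : u ≠ v₁) (huv₂ : u ≠ v₂) (hv : v₁ ≠ v₂) (hxu : x ≠ u) (hx₁ : x ≠ v₁) (hx₂ : x ≠ v₂)
    (hw₁u : w₁ ≠ u) (hw₂u : w₂ ≠ u) (hw₁v : w₁ ≠ v₁) (hw₂v : w₂ ≠ v₂)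
    (hNu : ∀ z, (core G).Adj u z ↔ z = v₁ ∨ z = v₂ ∨ z = x)
    (hN₁ : ∀ z, (core G).Adj v₁ z ↔ z = u ∨ z = w₁)
    (hN₂ : ∀ z, (core G).Adj v₂ z ↔ z = u ∨ z = w₂)
    (c : Sym2 V → Fin k) (D D' : V → Finset (Fin k))
    (hm : ∀ y z, K.Adj y z → c s(y, z) ∈ D y)
    (hint : ∀ y z, K.Adj y z → ∀ p ∈ D y, p ∈ D z → p = c s(y, z))
    (hinj : ∀ y z z', K.Adj y z → K.Adj y z' → c s(y, z) = c s(y, z') → z = z')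
    (hD' : ∀ y, y ≠ u → y ≠ v₁ → y ≠ v₂ → D' y = D y)
    (hcard : ∀ y, 2 ≤ G.degree y → (D' y).card = Δ)
    (a₁ a₂ b₁ b₂ c0 : Fin k) (hc0 : c0 = c s(u, x))
    (hE : w₁ = w₂ → a₁ ≠ a₂) (ht : w₁ = v₂ → a₁ = a₂)
    (hA₁ : ∀ z, K.Adj w₁ z → c s(w₁, z) ≠ a₁) (hA₂ : ∀ z, K.Adj w₂ z → c s(w₂, z) ≠ a₂)
    (c0U : c0 ∈ D' u) (b₁U : b₁ ∈ D' u) (b₂U : b₂ ∈ D' u) (hbb : b₁ ≠ b₂) (hcb₁ : c0 ≠ b₁)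
    (hcb₂ : c0 ≠ b₂) (hab₁ : a₁ ≠ b₁) (hab₂ : a₂ ≠ b₂)
    (hUX : ∀ p ∈ D' u, p ∈ D' x → p = c0)
    (a₁P : a₁ ∈ D' v₁) (b₁P : b₁ ∈ D' v₁) (a₂P : a₂ ∈ D' v₂) (b₂P : b₂ ∈ D' v₂)
    (a₁w : a₁ ∈ D' w₁) (a₂w : a₂ ∈ D' w₂)
    (hP₁ : ∀ p ∈ D' v₁, p ∈ D' w₁ → p = a₁) (hP₁U : ∀ p ∈ D' v₁, p ∈ D' u → p = b₁)
    (hP₂ : ∀ p ∈ D' v₂, p ∈ D' w₂ → p = a₂) (hP₂U : ∀ p ∈ D' v₂, p ∈ D' u → p = b₂) :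
    HasStrongColoring G k := by
  obtain ⟨c', hc'⟩ : ∃ c' : Sym2 V → Fin k, ∀ e, c' e =
      if e = s(u, v₁) then b₁ else if e = s(u, v₂) then b₂ else if e = s(v₁, w₁) then a₁
      else if e = s(v₂, w₂) then a₂ else c e := ⟨_, fun _ => rfl⟩
  have e1 : c' s(u, v₁) = b₁ := by rw [hc', if_pos rfl]
  have e2 : c' s(u, v₂) = b₂ := by
    rw [hc', if_neg (by simp only [Sym2.eq_iff]; grind), if_pos rfl]
  have e3 : c' s(v₁, w₁) = a₁ := by
    rw [hc', if_neg (by simp only [Sym2.eq_iff]; grind), if_neg (by simp only [Sym2.eq_iff]; grind),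
      if_pos rfl]
  have e4 : c' s(v₂, w₂) = a₂ := by
    rw [hc', if_neg (by simp only [Sym2.eq_iff]; grind), if_neg (by simp only [Sym2.eq_iff]; grind)]
    split_ifs with h
    · simp only [Sym2.eq_iff] at h
      exact ht (by grind)
    · rfl
    · rename_i h'; exact absurd rfl h'
  have e5 : ∀ y z, K.Adj y z → c' s(y, z) = c s(y, z) := by
    intro y z h
    obtain ⟨-, h1, h2, h3, h4⟩ := (hK y z).1 h
    rw [hc', if_neg, if_neg, if_neg, if_neg] <;> simp only [Sym2.eq_iff] <;> grind
  have hKux : K.Adj u x := (hK u x).2 ⟨(hNu x).2 (by simp), huv₁, huv₂, hx₁, hx₂⟩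
  have e6 : c' s(u, x) = c0 := by rw [e5 u x hKux, hc0]
  have hc0x : c0 ∈ D' x := by
    rw [hD' x hxu hx₁ hx₂, hc0, Sym2.eq_swap]
    exact hm x u hKux.symm
  let Q : V → V → Prop := fun y z => c' s(y, z) ∈ D' y ∧ c' s(y, z) ∈ D' z ∧
    ∀ p ∈ D' y, p ∈ D' z → p = c' s(y, z)
  have Qs : ∀ y z, Q y z → Q z y := by
    rintro y z ⟨h1, h2, h3⟩
    simp only [Q, Sym2.eq_swap (a := z) (b := y)]
    exact ⟨h2, h1, fun p hp hp' => h3 p hp' hp⟩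
  have Q1 : Q u v₁ := by
    simp only [Q, e1]
    exact ⟨b₁U, b₁P, fun p hp hp' => hP₁U p hp' hp⟩
  have Q2 : Q u v₂ := by
    simp only [Q, e2]
    exact ⟨b₂U, b₂P, fun p hp hp' => hP₂U p hp' hp⟩
  have Q3 : Q v₁ w₁ := by
    simp only [Q, e3]
    exact ⟨a₁P, a₁w, hP₁⟩
  have Q4 : Q v₂ w₂ := by
    simp only [Q, e4]
    exact ⟨a₂P, a₂w, hP₂⟩
  have Q5 : Q u x := by
    simp only [Q, e6]
    exact ⟨c0U, hc0x, hUX⟩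
  have Qu : ∀ z, (core G).Adj u z → Q u z := by
    intro z hz
    rcases (hNu z).1 hz with rfl | rfl | rfl
    exacts [Q1, Q2, Q5]
  have Qv₁ : ∀ z, (core G).Adj v₁ z → Q v₁ z := by
    intro z hz
    rcases (hN₁ z).1 hz with rfl | rfl
    exacts [Qs _ _ Q1, Q3]
  have Qv₂ : ∀ z, (core G).Adj v₂ z → Q v₂ z := by
    intro z hz
    rcases (hN₂ z).1 hz with rfl | rfl
    exacts [Qs _ _ Q2, Q4]
  have Qall : ∀ y z, (core G).Adj y z → Q y z := by
    intro y z h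
    by_cases y1 : y = u
    · subst y1; exact Qu z h
    by_cases y2 : y = v₁
    · subst y2; exact Qv₁ z h
    by_cases y3 : y = v₂
    · subst y3; exact Qv₂ z h
    by_cases z1 : z = u
    · subst z1; exact Qs _ _ (Qu y h.symm)
    by_cases z2 : z = v₁
    · subst z2; exact Qs _ _ (Qv₁ y h.symm)
    by_cases z3 : z = v₂
    · subst z3; exact Qs _ _ (Qv₂ y h.symm)
    have hk : K.Adj y z := (hK y z).2 ⟨h, y2, y3, z2, z3⟩
    simp only [Q, e5 y z hk, hD' y y1 y2 y3, hD' z z1 z2 z3]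
    refine ⟨hm y z hk, ?_, hint y z hk⟩
    rw [Sym2.eq_swap]
    exact hm z y hk.symm
  refine assemble G c' D' (fun y hy => (hcard y hy).symm ▸ hmax y) (fun y z h => (Qall y z h).1)
    (fun y z h => (Qall y z h).2.2) ?_
  intro y z z' hz hz' heq
  by_cases y1 : y = u
  · subst y1
    rcases (hNu z).1 hz with rfl | rfl | rfl <;> rcases (hNu z').1 hz' with rfl | rfl | rfl <;>
      grind
  by_cases y2 : y = v₁
  · subst y2
    have e1' : c' s(y, u) = b₁ := by rw [Sym2.eq_swap, e1]
    rcases (hN₁ z).1 hz with rfl | rfl <;> rcases (hN₁ z').1 hz' with rfl | rfl <;> grind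
  by_cases y3 : y = v₂
  · subst y3
    have e2' : c' s(y, u) = b₂ := by rw [Sym2.eq_swap, e2]
    rcases (hN₂ z).1 hz with rfl | rfl <;> rcases (hN₂ z').1 hz' with rfl | rfl <;> grind
  have tri : ∀ z, (core G).Adj y z → (z = v₁ ∧ y = w₁ ∧ c' s(y, z) = a₁) ∨
      (z = v₂ ∧ y = w₂ ∧ c' s(y, z) = a₂) ∨ (K.Adj y z ∧ c' s(y, z) = c s(y, z)) := by
    intro z hz
    by_cases z2 : z = v₁
    · subst z2
      rcases (hN₁ y).1 hz.symm with h | h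
      · exact absurd h y1
      · subst h
        exact Or.inl ⟨rfl, rfl, by rw [Sym2.eq_swap, e3]⟩
    by_cases z3 : z = v₂
    · subst z3
      rcases (hN₂ y).1 hz.symm with h | h
      · exact absurd h y1
      · subst h
        exact Or.inr (Or.inl ⟨rfl, rfl, by rw [Sym2.eq_swap, e4]⟩)
    have hk : K.Adj y z := (hK y z).2 ⟨hz, y2, y3, z2, z3⟩
    exact Or.inr (Or.inr ⟨hk, e5 y z hk⟩)
  rcases tri z hz with ⟨h1, h2, h3⟩ | ⟨h1, h2, h3⟩ | ⟨h1, h2⟩ <;>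
    rcases tri z' hz' with ⟨g1, g2, g3⟩ | ⟨g1, g2, g3⟩ | ⟨g1, g2⟩
  · rw [h1, g1]
  · exact absurd (h3.symm.trans (heq.trans g3)) (hE (h2.symm.trans g2))
  · exact absurd (g2.symm.trans (heq.symm.trans h3)) (h2 ▸ hA₁ z' (h2 ▸ g1))
  · exact absurd (g3.symm.trans (heq.symm.trans h3)) (hE (g2.symm.trans h2))
  · rw [h1, g1]
  · exact absurd (g2.symm.trans (heq.symm.trans h3)) (h2 ▸ hA₂ z' (h2 ▸ g1))
  · exact absurd (h2.symm.trans (heq.trans g3)) (g2 ▸ hA₁ z (g2 ▸ h1))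
  · exact absurd (h2.symm.trans (heq.trans g3)) (g2 ▸ hA₂ z (g2 ▸ h1))
  · exact hinj y z z' h1 g1 (h2.symm.trans (heq.trans g2))

/-- In a minimal counterexample `G` to `χ'_s ≤ 3Δ - 3` for graphs with `Mad < 8/3` and
maximum degree at most `Δ ≥ 9`, if a vertex of degree 3 in `G*` has two neighbors of
degree 2 in `G*`, then at least one of them is special. -/
theorem minCexA_three_vertex_special_neighbor (Δ : ℕ) (hΔ : 9 ≤ Δ) {V : Type}
    [Fintype V] (G : SimpleGraph V) (hG : MinCexA Δ G) (u v₁ v₂ : V)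
    (hu : (core G).degree u = 3)
    (h1 : (core G).Adj u v₁) (h2 : (core G).Adj u v₂) (hne : v₁ ≠ v₂)
    (hd1 : (core G).degree v₁ = 2) (hd2 : (core G).degree v₂ = 2) :
    Special Δ G v₁ ∨ Special Δ G v₂ := by
  by_contra hcon
  push Not at hcon
  obtain ⟨hs1, hs2⟩ := hcon
  have hmax : ∀ y, G.degree y ≤ Δ := fun y => (G.degree_le_maxDegree y).trans hG.1.2
  -- the remaining neighbors
  obtain ⟨x, hx₁, hx₂, hNu⟩ : ∃ x, x ≠ v₁ ∧ x ≠ v₂ ∧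
      ∀ z, (core G).Adj u z ↔ z = v₁ ∨ z = v₂ ∨ z = x := by
    rw [← SimpleGraph.card_neighborFinset_eq_degree] at hu
    have hsub : ({v₁, v₂} : Finset V) ⊆ (core G).neighborFinset u := by
      intro a ha
      simp only [Finset.mem_insert, Finset.mem_singleton] at ha
      rcases ha with rfl | rfl <;> simpa
    have h := Finset.card_sdiff_of_subset hsub
    rw [hu, Finset.card_pair hne] at h
    obtain ⟨x, hx⟩ := Finset.card_eq_one.1 h
    have hxm : ∀ z, z ∈ (core G).neighborFinset u \ {v₁, v₂} ↔ z = x := by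
      intro z; rw [hx, Finset.mem_singleton]
    simp only [Finset.mem_sdiff, SimpleGraph.mem_neighborFinset, Finset.mem_insert,
      Finset.mem_singleton, not_or] at hxm
    have hx' := (hxm x).2 rfl
    refine ⟨x, hx'.2.1, hx'.2.2, fun z => ?_⟩
    constructor
    · intro hz
      by_cases z1 : z = v₁
      · exact Or.inl z1
      by_cases z2 : z = v₂
      · exact Or.inr (Or.inl z2)
      exact Or.inr (Or.inr ((hxm z).1 ⟨hz, z1, z2⟩))
    · rintro (rfl | rfl | rfl)
      exacts [h1, h2, hx'.1]
  have other : ∀ v, (core G).Adj u v → (core G).degree v = 2 →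
      ∃ w, w ≠ u ∧ ∀ z, (core G).Adj v z ↔ z = u ∨ z = w := by
    intro v hv hd
    rw [← SimpleGraph.card_neighborFinset_eq_degree] at hd
    have hum : u ∈ (core G).neighborFinset v := by simpa using hv.symm
    have h := Finset.card_erase_of_mem hum
    rw [hd] at h
    obtain ⟨w, hw⟩ := Finset.card_eq_one.1 h
    have hwm : ∀ z, z ∈ ((core G).neighborFinset v).erase u ↔ z = w := by
      intro z; rw [hw, Finset.mem_singleton]
    simp only [Finset.mem_erase, SimpleGraph.mem_neighborFinset] at hwm
    have hw' := (hwm w).2 rfl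
    refine ⟨w, hw'.1, fun z => ?_⟩
    constructor
    · intro hz
      by_cases z1 : z = u
      · exact Or.inl z1
      exact Or.inr ((hwm z).1 ⟨z1, hz⟩)
    · rintro (rfl | rfl)
      exacts [hv.symm, hw'.2]
  obtain ⟨w₁, hw₁u, hN₁⟩ := other v₁ h1 hd1
  obtain ⟨w₂, hw₂u, hN₂⟩ := other v₂ h2 hd2
  have hvw₁ : (core G).Adj v₁ w₁ := (hN₁ w₁).2 (Or.inr rfl)
  have hvw₂ : (core G).Adj v₂ w₂ := (hN₂ w₂).2 (Or.inr rfl)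
  have hux : (core G).Adj u x := (hNu x).2 (by simp)
  have hdw₁ : (core G).degree w₁ < Δ - 1 := by
    by_contra h
    exact hs1 ⟨hd1, w₁, hvw₁, by omega⟩
  have hdw₂ : (core G).degree w₂ < Δ - 1 := by
    by_contra h
    exact hs2 ⟨hd2, w₂, hvw₂, by omega⟩
  have huv₁ : u ≠ v₁ := h1.ne
  have huv₂ : u ≠ v₂ := h2.ne
  have hxu : x ≠ u := hux.ne.symm
  have hw₁v : w₁ ≠ v₁ := hvw₁.ne.symm
  have hw₂v : w₂ ≠ v₂ := hvw₂.ne.symm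
  -- the reduced graph
  obtain ⟨K, hK⟩ : ∃ K : SimpleGraph V, ∀ y z, K.Adj y z ↔
      (core G).Adj y z ∧ y ≠ v₁ ∧ y ≠ v₂ ∧ z ≠ v₁ ∧ z ≠ v₂ :=
    ⟨{ Adj := fun y z => (core G).Adj y z ∧ y ≠ v₁ ∧ y ≠ v₂ ∧ z ≠ v₁ ∧ z ≠ v₂
       symm := ⟨fun y z h => ⟨h.1.symm, h.2.2.2.1, h.2.2.2.2, h.2.1, h.2.2.1⟩⟩
       loopless := ⟨fun y h => h.1.ne rfl⟩ }, fun y z => Iff.rfl⟩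
  have hKG : K ≤ G := fun y z h => (core_adj'.1 ((hK y z).1 h).1).1
  let S : Finset V :=
    (Finset.univ.filter (fun y => 2 ≤ G.degree y)).filter (fun y => y ≠ u ∧ y ≠ v₁ ∧ y ≠ v₂)
  have hSmem : ∀ y, y ∈ S ↔ 2 ≤ G.degree y ∧ y ≠ u ∧ y ≠ v₁ ∧ y ≠ v₂ := by
    intro y; simp [S]
  have hScard : S.card < twoPlusCount G := by
    apply Finset.card_lt_card
    rw [Finset.ssubset_iff_of_subset (Finset.filter_subset _ _)]
    refine ⟨u, ?_, ?_⟩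
    · simpa using (core_adj'.1 h1).2.1
    · simp
  have hS1 : ∀ y, y ∉ S → K.degree y ≤ 1 := by
    intro y hy
    rw [← SimpleGraph.card_neighborFinset_eq_degree, Finset.card_le_one]
    intro a ha b hb
    rw [SimpleGraph.mem_neighborFinset, hK] at ha hb
    have hyu : y = u := by
      by_contra hyu
      exact hy ((hSmem y).2 ⟨(core_adj'.1 ha.1).2.1, hyu, ha.2.1, ha.2.2.1⟩)
    subst hyu
    have hax : a = x := by
      rcases (hNu a).1 ha.1 with h | h | h
      exacts [absurd h ha.2.2.2.1, absurd h ha.2.2.2.2, h]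
    have hbx : b = x := by
      rcases (hNu b).1 hb.1 with h | h | h
      exacts [absurd h hb.2.2.2.1, absurd h hb.2.2.2.2, h]
    rw [hax, hbx]
  obtain ⟨c, D, hDc, hm, hint, hinj⟩ := palettes (by omega) hG K hKG S hScard hS1
  have hKux : K.Adj u x := (hK u x).2 ⟨hux, huv₁, huv₂, hx₁, hx₂⟩
  have hxS : x ∈ S := (hSmem x).2 ⟨(core_adj'.1 hux).2.2, hxu, hx₁, hx₂⟩
  have hc0x : c s(u, x) ∈ D x := by
    rw [Sym2.eq_swap]; exact hm x u hKux.symm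
  have mkD : ∀ U P₁ P₂ : Finset (Fin (3 * Δ - 3)), ∃ D' : V → Finset (Fin (3 * Δ - 3)),
      D' u = U ∧ D' v₁ = P₁ ∧ D' v₂ = P₂ ∧ ∀ y, y ≠ u → y ≠ v₁ → y ≠ v₂ → D' y = D y := by
    intro U P₁ P₂
    refine ⟨fun y => if y = u then U else if y = v₁ then P₁ else if y = v₂ then P₂ else D y,
      ?_, ?_, ?_, ?_⟩
    · simp
    · simp [huv₁.symm]
    · simp [huv₂.symm, hne.symm]
    · intro y y1 y2 y3
      simp [y1, y2, y3]
  have hcardD' : ∀ D' : V → Finset (Fin (3 * Δ - 3)), (D' u).card = Δ → (D' v₁).card = Δ →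
      (D' v₂).card = Δ → (∀ y, y ≠ u → y ≠ v₁ → y ≠ v₂ → D' y = D y) →
      ∀ y, 2 ≤ G.degree y → (D' y).card = Δ := by
    intro D' c1 c2 c3 h y hy
    by_cases y1 : y = u
    · rw [y1, c1]
    by_cases y2 : y = v₁
    · rw [y2, c2]
    by_cases y3 : y = v₂
    · rw [y3, c3]
    rw [h y y1 y2 y3]
    exact hDc y ((hSmem y).2 ⟨hy, y1, y2, y3⟩)
  apply hG.2.1
  by_cases htri : w₁ = v₂
  · -- triangle case
    have hw₂ : w₂ = v₁ := by
      rcases (hN₂ v₁).1 (htri ▸ hvw₁.symm) with h | h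
      · exact absurd h huv₁.symm
      · exact h.symm
    obtain ⟨a, b₁, b₂, U, P₁, P₂, cU, cP₁, cP₂, c0U, b₁U, b₂U, hbb, hcb₁, hcb₂, hab₁, hab₂, hUX,
      a₁P, b₁P, a₂P, b₂P, hPP, hP₁U, hP₂U⟩ :=
      set_problem_triangle hΔ (D x) (c s(u, x)) (hDc x hxS) hc0x
    obtain ⟨D', rfl, rfl, rfl, hD'⟩ := mkD U P₁ P₂
    refine finish G K hmax u v₁ v₂ x w₁ w₂ hK huv₁ huv₂ hne hxu hx₁ hx₂ hw₁u hw₂u hw₁v hw₂v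
      hNu hN₁ hN₂ c D D' hm hint hinj hD' (hcardD' D' cU cP₁ cP₂ hD') a a b₁ b₂ (c s(u, x)) rfl
      ?_ (fun _ => rfl) ?_ ?_ c0U b₁U b₂U hbb hcb₁ hcb₂ hab₁ hab₂
      (by rw [hD' x hxu hx₁ hx₂]; exact hUX) a₁P b₁P a₂P b₂P (by rw [htri]; exact a₂P)
      (by rw [hw₂]; exact a₁P) (by rw [htri]; exact hPP) hP₁U
      (by rw [hw₂]; exact fun p hp hp' => hPP p hp' hp) hP₂U
    · intro h
      rw [htri, hw₂] at h
      exact absurd h.symm hne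
    · intro z hz
      exact absurd htri ((hK _ _).1 hz).2.2.1
    · intro z hz
      exact absurd hw₂ ((hK _ _).1 hz).2.1
  · -- main case
    have htri' : w₂ ≠ v₁ := by
      intro h
      rcases (hN₁ v₂).1 (h ▸ hvw₂.symm) with h' | h'
      · exact huv₂ h'.symm
      · exact htri h'.symm
    have hw₁S : w₁ ∈ S := (hSmem w₁).2 ⟨(core_adj'.1 hvw₁).2.2, hw₁u, hw₁v, htri⟩
    have hw₂S : w₂ ∈ S := (hSmem w₂).2 ⟨(core_adj'.1 hvw₂).2.2, hw₂u, htri', hw₂v⟩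
    let A : V → Finset (Fin (3 * Δ - 3)) :=
      fun w => D w \ (K.neighborFinset w).image (fun z => c s(w, z))
    have hAcard : ∀ w ∈ S, Δ - K.degree w ≤ (A w).card := by
      intro w hw
      have h := Finset.le_card_sdiff ((K.neighborFinset w).image (fun z => c s(w, z))) (D w)
      have h' := Finset.card_image_le (s := K.neighborFinset w) (f := fun z => c s(w, z))
      rw [SimpleGraph.card_neighborFinset_eq_degree] at h'
      rw [hDc w hw] at h
      simp only [A]
      omega
    have hAmem : ∀ w, ∀ a ∈ A w, ∀ z, K.Adj w z → c s(w, z) ≠ a := by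
      intro w a ha z hz h
      refine (Finset.mem_sdiff.1 ha).2 (Finset.mem_image.2 ⟨z, ?_, h⟩)
      simpa using hz
    have hKdeg : ∀ w (T : Finset V), T ⊆ (core G).neighborFinset w → T ⊆ {v₁, v₂} →
        K.degree w + T.card ≤ (core G).degree w := by
      intro w T hT hT'
      rw [← SimpleGraph.card_neighborFinset_eq_degree, ← SimpleGraph.card_neighborFinset_eq_degree,
        ← Finset.card_union_of_disjoint]
      · apply Finset.card_le_card
        apply Finset.union_subset _ hT
        intro z hz
        rw [SimpleGraph.mem_neighborFinset] at hz ⊢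
        exact ((hK _ _).1 hz).1
      · rw [Finset.disjoint_left]
        intro z hz hz'
        rw [SimpleGraph.mem_neighborFinset, hK] at hz
        have := hT' hz'
        simp only [Finset.mem_insert, Finset.mem_singleton] at this
        rcases this with h | h
        · exact hz.2.2.2.1 h
        · exact hz.2.2.2.2 h
    have k1 := hKdeg w₁ {v₁} (by simpa using hvw₁.symm) (by simp)
    have k2 := hKdeg w₂ {v₂} (by simpa using hvw₂.symm) (by simp)
    rw [Finset.card_singleton] at k1 k2
    have A1 := hAcard w₁ hw₁S
    have A2 := hAcard w₂ hw₂S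
    obtain ⟨a₁, a₂, b₁, b₂, U, P₁, P₂, ha₁, ha₂, hE, cU, cP₁, cP₂, c0U, b₁U, b₂U, hbb, hcb₁, hcb₂,
      hab₁, hab₂, hUX, a₁P, b₁P, a₂P, b₂P, hP₁, hP₁U, hP₂, hP₂U⟩ :=
      set_problem hΔ (D x) (D w₁) (D w₂) (A w₁) (A w₂) (c s(u, x)) (hDc x hxS) (hDc _ hw₁S)
        (hDc _ hw₂S) hc0x Finset.sdiff_subset Finset.sdiff_subset (by omega) (by omega)
        (w₁ = w₂) (by
          intro h
          have k3 := hKdeg w₂ {v₁, v₂} (by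
            intro z hz
            simp only [Finset.mem_insert, Finset.mem_singleton] at hz
            rw [SimpleGraph.mem_neighborFinset]
            rcases hz with rfl | rfl
            · exact h ▸ hvw₁.symm
            · exact hvw₂.symm) (Finset.Subset.refl _)
          rw [Finset.card_pair hne] at k3
          omega)
    obtain ⟨D', rfl, rfl, rfl, hD'⟩ := mkD U P₁ P₂
    have r1 : D' w₁ = D w₁ := hD' w₁ hw₁u hw₁v htri
    have r2 : D' w₂ = D w₂ := hD' w₂ hw₂u htri' hw₂v
    exact finish G K hmax u v₁ v₂ x w₁ w₂ hK huv₁ huv₂ hne hxu hx₁ hx₂ hw₁u hw₂u hw₁v hw₂v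
      hNu hN₁ hN₂ c D D' hm hint hinj hD' (hcardD' D' cU cP₁ cP₂ hD') a₁ a₂ b₁ b₂ (c s(u, x)) rfl
      hE (fun h => absurd h htri) (hAmem w₁ a₁ ha₁) (hAmem w₂ a₂ ha₂) c0U b₁U b₂U hbb hcb₁ hcb₂
      hab₁ hab₂ (by rw [hD' x hxu hx₁ hx₂]; exact hUX) a₁P b₁P a₂P b₂P
      (by rw [r1]; exact (Finset.mem_sdiff.1 ha₁).1) (by rw [r2]; exact (Finset.mem_sdiff.1 ha₂).1)
      (by rw [r1]; exact hP₁) hP₁U (by rw [r2]; exact hP₂) hP₂U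

end StrongEC
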